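/- Let n ≥ 1, let g and g' be positive definite Hermitian n×n complex matrices, let C ≥ 1 and K ≥ 0 be real numbers, and let H be a Hermitian n×n complex matrix. Assume the Loewner order inequalities C⁻¹·g ≤ g' ≤ C·g (i.e. g' − C⁻¹g and Cg − g' are positive semidefinite) and H + K·g is positive semidefinite (i.e. H ≥ −K·g). Then the real numbers tr(g⁻¹H) and tr(g'⁻¹H) satisfy tr(g⁻¹H) ≤ C·tr(g'⁻¹H) + n·K·(C² − 1). -/

import Mathlib

open scoped ComplexOrder

lemma aux_trace {n : ℕ} {P Q : Matrix (Fin n) (Fin n) ℂ} (hP : P.PosSemidef)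
    (hQ : Q.PosSemidef) : 0 ≤ (P * Q).trace.re := by
  obtain ⟨B, rfl⟩ : ∃ B : Matrix (Fin n) (Fin n) ℂ, Q = B.conjTranspose * B := by
    open scoped MatrixOrder in
    exact CStarAlgebra.nonneg_iff_eq_star_mul_self.mp hQ.nonneg
  have h := (hP.mul_mul_conjTranspose_same B).trace_nonneg
  have e : (P * (B.conjTranspose * B)).trace = (B * P * B.conjTranspose).trace := by
    rw [← Matrix.mul_assoc, Matrix.trace_mul_comm, Matrix.mul_assoc]
  rw [e]
  exact (Complex.le_def.mp h).1

lemma aux_inv {n : ℕ} {A B : Matrix (Fin n) (Fin n) ℂ} (hA : A.PosDef) (hB : B.PosDef)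
    (h : (A - B).PosSemidef) : (B⁻¹ - A⁻¹).PosSemidef := by
  have hAu : IsUnit A.det := (Matrix.isUnit_iff_isUnit_det A).mp hA.isUnit
  have hBu : IsUnit B.det := (Matrix.isUnit_iff_isUnit_det B).mp hB.isUnit
  have hAi : (A⁻¹).conjTranspose = A⁻¹ := hA.inv.1
  have hBi : (B⁻¹).conjTranspose = B⁻¹ := hB.inv.1
  have h1 := hB.posSemidef.mul_mul_conjTranspose_same (B⁻¹ - A⁻¹)
  have h2 := h.mul_mul_conjTranspose_same A⁻¹
  rw [Matrix.conjTranspose_sub, hAi, hBi] at h1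
  rw [hAi] at h2
  convert h1.add h2 using 1
  simp only [Matrix.sub_mul, Matrix.mul_sub, Matrix.nonsing_inv_mul _ hAu,
    Matrix.nonsing_inv_mul _ hBu, Matrix.mul_assoc, Matrix.mul_nonsing_inv _ hBu, Matrix.mul_nonsing_inv _ hAu, Matrix.mul_one, Matrix.one_mul]
  simp only [← Matrix.mul_assoc, Matrix.nonsing_inv_mul _ hBu, Matrix.one_mul]
  abel

/-- If `C⁻¹ g ≤ g' ≤ C g` in the Loewner order (with `g`, `g'` positive definite
Hermitian, `C ≥ 1`), and the Hermitian matrix `H` satisfies `H ≥ -K g` with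
`K ≥ 0`, then `tr(g⁻¹ H) ≤ C tr(g'⁻¹ H) + n K (C² - 1)`. -/
theorem trace_comparison (n : ℕ) (hn : 1 ≤ n)
    (g g' : Matrix (Fin n) (Fin n) ℂ) (hg : g.PosDef) (hg' : g'.PosDef)
    (C K : ℝ) (hC : 1 ≤ C) (hK : 0 ≤ K)
    (H : Matrix (Fin n) (Fin n) ℂ) (hH : H.IsHermitian)
    (h_lower : (g' - (C⁻¹ : ℂ) • g).PosSemidef)
    (h_upper : ((C : ℂ) • g - g').PosSemidef)
    (h_H : (H + (K : ℂ) • g).PosSemidef) :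
    (g⁻¹ * H).trace.re ≤ C * (g'⁻¹ * H).trace.re + n * K * (C ^ 2 - 1) := by
  have hC0 : 0 < C := by linarith
  have hCc : (C : ℂ) ≠ 0 := by exact_mod_cast hC0.ne'
  have hCp : (0 : ℂ) < (C : ℂ) := by exact_mod_cast hC0
  have hgu : IsUnit g.det := (Matrix.isUnit_iff_isUnit_det g).mp hg.isUnit
  have hgu' : IsUnit g'.det := (Matrix.isUnit_iff_isUnit_det g').mp hg'.isUnit
  have h1 := aux_inv (hg.smul hCp) hg' h_upper
  have e : ((C : ℂ) • g)⁻¹ = ((C⁻¹ : ℝ) : ℂ) • g⁻¹ := by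
    apply Matrix.inv_eq_right_inv
    rw [Matrix.smul_mul, Matrix.mul_smul, Matrix.mul_nonsing_inv _ hgu, smul_smul]
    simp [hCc]
  rw [e] at h1
  have h2 := aux_trace h1 h_H
  have h3 := aux_trace hg'.inv.posSemidef h_lower
  rw [← Complex.ofReal_inv] at h3
  simp only [Matrix.sub_mul, Matrix.mul_sub, Matrix.mul_add, Matrix.smul_mul, Matrix.mul_smul,
    Matrix.nonsing_inv_mul _ hgu, Matrix.nonsing_inv_mul _ hgu', Matrix.trace_sub,
    Matrix.trace_add, Matrix.trace_smul, Matrix.trace_one, smul_eq_mul, Complex.sub_re,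
    Complex.add_re, Complex.re_ofReal_mul, Fintype.card_fin, Complex.natCast_re] at h2 h3
  have h4 := mul_nonneg hC0.le h2
  have h5 := mul_nonneg (mul_nonneg hK (sq_nonneg C)) h3
  have hi : C * C⁻¹ = 1 := mul_inv_cancel₀ hC0.ne'
  set x := (g⁻¹ * H).trace.re
  set y := (g'⁻¹ * H).trace.re
  set z := (g'⁻¹ * g).trace.re
  linear_combination h4 + h5 + (-x - K * n - K * C * z) * hi
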